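/- Let μ1 be the match produced by the student-proposing Deferred Acceptance algorithm. If a student i strictly prefers a school s to her assignment μ1(i), then s is filled to capacity at μ1, i.e., |μ1⁻¹(s)| = q_s. -/

import Mathlib

/-- A school choice problem.  Students `I` and schools `S` are finite types.
A match sends each student to `some s` (a school) or `none` (unmatched, i.e.
matched to herself).  Strict preferences/priorities are encoded by injective
numerical rank functions (higher value = more preferred / higher priority);
the weak between-group priority is encoded by an arbitrary rank function,
whose level sets are the priority groups. -/
structure SchoolChoice (I S : Type*) [Fintype I] [Fintype S] where
  /-- the capacity of each school -/
  q : S → ℕ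
  /-- each school has at least one seat -/
  q_pos : ∀ s, 1 ≤ q s
  /-- student `i`'s strict preference over `S ∪ {i}` (`none` = being unmatched) -/
  pref : I → Option S → ℕ
  pref_inj : ∀ i, Function.Injective (pref i)
  /-- the between-group priority of school `s` (a weak order on students) -/
  btw : S → I → ℕ
  /-- the within-group priority of school `s` (a strict total order on students) -/
  wthn : S → I → ℕ
  wthn_inj : ∀ s, Function.Injective (wthn s)
  /-- the within-group priority refines the between-group priority -/
  refines : ∀ s i j, btw s i < btw s j → wthn s i < wthn s j

namespace SchoolChoice

variable {I S : Type*} [Fintype I] [Fintype S] (P : SchoolChoice I S)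

/-- `μ` is a match: no school is assigned more students than its capacity. -/
def IsMatch (μ : I → Option S) : Prop :=
  ∀ s : S, {i | μ i = some s}.ncard ≤ P.q s

/-- `μ` is individually rational: every student weakly prefers her assignment
to being unmatched. -/
def IndRational (μ : I → Option S) : Prop :=
  ∀ i, P.pref i none ≤ P.pref i (μ i)

/-- Coalition `A` prefers `ν` to `μ`: all members weakly, some member strictly. -/
def Prefers (A : Set I) (ν μ : I → Option S) : Prop :=
  (∀ i ∈ A, P.pref i (μ i) ≤ P.pref i (ν i)) ∧ ∃ i ∈ A, P.pref i (μ i) < P.pref i (ν i)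

/-- The priority group `[i]_s` of student `i` at school `s`. -/
def Group (s : S) (i : I) : Set I := {j | P.btw s j = P.btw s i}

/-- `A` can between-group enforce `ν` over `μ`: every member assigned a school
by `ν` either displaces a student of strictly lower between-group priority or
takes an empty seat (a student can always enforce becoming unmatched). -/
def BtwEnforce (A : Set I) (ν μ : I → Option S) : Prop :=
  ∀ i ∈ A, ∀ s, ν i = some s →
    (∃ j, μ j = some s ∧ P.btw s j < P.btw s i) ∨ {j | μ j = some s}.ncard < P.q s

/-- `A` between-group blocks `μ`. -/
def BtwBlocks (A : Set I) (μ : I → Option S) : Prop :=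
  ∃ ν, P.IsMatch ν ∧ P.BtwEnforce A ν μ ∧ P.Prefers A ν μ

/-- The responsive set extension `A ≿_s B` of the between-group priority:
`B` is no larger than `A`, and the students of `B` can be paired injectively
with students of `A` of weakly higher between-group priority. -/
def SetGE (s : S) (A B : Set I) : Prop :=
  B.ncard ≤ A.ncard ∧
    ∃ g : I → I, Set.InjOn g B ∧ Set.MapsTo g B A ∧ ∀ b ∈ B, P.btw s b ≤ P.btw s (g b)

/-- Set indifference `A ∼_s B` under the responsive extension. -/
def SetSim (s : S) (A B : Set I) : Prop := P.SetGE s A B ∧ P.SetGE s B A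

/-- The within-group upper contour set `U_s(i)`: the students in `i`'s priority
group at `s` with weakly higher within-group priority. -/
def UCS (s : S) (i : I) : Set I :=
  {j | P.btw s j = P.btw s i ∧ P.wthn s i ≤ P.wthn s j}

/-- The pairs `(i, j)` where `i ∈ A` is sent to `s` by `ν` and `j` is a
within-group interrupter of `i` (i.e. `j ∈ U_s(i) \ A`).  Its cardinality is
the total number of within-group interrupters across all members of `A`
matched to `s` by `ν`. -/
def InterruptPairs (A : Set I) (ν : I → Option S) (s : S) : Set (I × I) :=
  {p | p.1 ∈ A ∧ ν p.1 = some s ∧ p.2 ∈ P.UCS s p.1 ∧ p.2 ∉ A}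

/-- `A` can within-group enforce `ν` over `μ`: for every school in `ν(A)`,
(1) `ν⁻¹(s) ∼_s μ⁻¹(s)` and (2) the total number of within-group interrupters
is at most `q s - |ν⁻¹(s)|`. -/
def WthnEnforce (A : Set I) (ν μ : I → Option S) : Prop :=
  ∀ s : S, (∃ i ∈ A, ν i = some s) →
    P.SetSim s {j | ν j = some s} {j | μ j = some s} ∧
    (P.InterruptPairs A ν s).ncard ≤ P.q s - {j | ν j = some s}.ncard

/-- `A` within-group blocks `μ`. -/
def WthnBlocks (A : Set I) (μ : I → Option S) : Prop :=
  ∃ ν, P.IsMatch ν ∧ P.WthnEnforce A ν μ ∧ P.Prefers A ν μ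

/-- The unified core: no coalition between-group blocks nor within-group
blocks the match. -/
def UnifiedCore (μ : I → Option S) : Prop :=
  (∀ A : Set I, ¬ P.BtwBlocks A μ) ∧ ∀ A : Set I, ¬ P.WthnBlocks A μ

/-- A match is fair (w.r.t. the within-group priorities, à la Gale–Shapley):
no student prefers a school that has an empty seat or admits a student of
strictly lower within-group priority. -/
def Fair (μ : I → Option S) : Prop :=
  ¬ ∃ (i : I) (s : S), P.pref i (μ i) < P.pref i (some s) ∧
    ((∃ j, μ j = some s ∧ P.wthn s j < P.wthn s i) ∨ {j | μ j = some s}.ncard < P.q s)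

/-! ### The student-proposing Deferred Acceptance algorithm,
specified relationally.  The state is the map `R` sending each student to the
set of schools that have rejected her so far. -/

/-- Given rejections `R`, student `i` currently proposes to `o`: `o` is not a
school that rejected `i`, and `o` is her most-preferred such option in
`S ∪ {i}`. -/
def ProposesTo (R : I → Set S) (i : I) (o : Option S) : Prop :=
  (∀ s, o = some s → s ∉ R i) ∧
  ∀ o' : Option S, (∀ s, o' = some s → s ∉ R i) → P.pref i o' ≤ P.pref i o

/-- Given rejections `R`, school `s` now rejects `i`: `i` proposes to `s` and
at least `q s` current proposers have strictly higher within-group priority. -/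
def Rejects (R : I → Set S) (s : S) (i : I) : Prop :=
  P.ProposesTo R i (some s) ∧
  P.q s ≤ {j | P.ProposesTo R j (some s) ∧ P.wthn s i < P.wthn s j}.ncard

/-- One round of Deferred Acceptance: some school is over-demanded, and every
over-demanded school rejects all but its `≻*`-top `q s` proposers. -/
def DAStep (R R' : I → Set S) : Prop :=
  (∃ s, P.q s < {i | P.ProposesTo R i (some s)}.ncard) ∧
  ∀ i, R' i = R i ∪ {s | P.Rejects R s i}

/-- Deferred Acceptance terminates: no school is over-demanded. -/
def DATerminal (R : I → Set S) : Prop :=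
  ∀ s, {i | P.ProposesTo R i (some s)}.ncard ≤ P.q s

/-- `μ1` is the outcome of the student-proposing Deferred Acceptance
algorithm: starting from no rejections, rounds are iterated until no school is
over-demanded, and every student is matched to the agent she last proposed to. -/
def IsDAOutcome (μ1 : I → Option S) : Prop :=
  ∃ (n : ℕ) (R : ℕ → I → Set S),
    (∀ i, R 0 i = ∅) ∧ (∀ k < n, P.DAStep (R k) (R (k + 1))) ∧
    P.DATerminal (R n) ∧ ∀ i, P.ProposesTo (R n) i (μ1 i)

/-! ### The restricted Top Trading Cycles stage, starting from a match `μ1`,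
specified relationally.  The state is the pair of the set of active students
and the current assignment. -/

/-- Student `i` is initially active in the TTC stage: she is matched by `μ1`
to a school at which she lies in the lowest priority group among the students
matched there. -/
def InitActive (μ1 : I → Option S) (i : I) : Prop :=
  ∃ s, μ1 i = some s ∧ ∀ j, μ1 j = some s → P.btw s i ≤ P.btw s j

/-- School `s` is admissible to student `i` (given active students `Act`):
some active student assigned to `s` by `μ1` is in the same priority group as
`i` at `s`.  (In particular `s` is then an active school.) -/
def Admissible (μ1 : I → Option S) (Act : Set I) (i : I) (s : S) : Prop :=
  ∃ j ∈ Act, μ1 j = some s ∧ P.btw s i = P.btw s j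

/-- Active student `i` points to school `s`: `s` is her most-preferred
admissible active school. -/
def StuPoints (μ1 : I → Option S) (Act : Set I) (i : I) (s : S) : Prop :=
  i ∈ Act ∧ P.Admissible μ1 Act i s ∧
  ∀ s', P.Admissible μ1 Act i s' → P.pref i (some s') ≤ P.pref i (some s)

/-- Active school `s` points to student `i`: `i` is the `≻*_s`-highest active
student in `μ1⁻¹(s)`. -/
def SchPoints (μ1 : I → Option S) (Act : Set I) (s : S) (i : I) : Prop :=
  i ∈ Act ∧ μ1 i = some s ∧ ∀ j ∈ Act, μ1 j = some s → P.wthn s j ≤ P.wthn s i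

/-- A (pointing) cycle `i₁, s₁, …, iₙ, sₙ` of distinct active students and
active schools: each student `c k` points to school `d k`, and each school
`d k` points to the cyclically next student `c (k+1)`. -/
def IsCycle (μ1 : I → Option S) (Act : Set I) {n : ℕ}
    (c : Fin (n + 1) → I) (d : Fin (n + 1) → S) : Prop :=
  Function.Injective c ∧ Function.Injective d ∧
  (∀ k, P.StuPoints μ1 Act (c k) (d k)) ∧
  ∀ k, P.SchPoints μ1 Act (d k) (c (k + 1))

/-- One round of the restricted TTC stage: a cycle forms, each student on the
cycle is assigned the school she points to and is deactivated; all other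
assignments are unchanged. -/
def TTCStep (μ1 : I → Option S) (st st' : Set I × (I → Option S)) : Prop :=
  ∃ (n : ℕ) (c : Fin (n + 1) → I) (d : Fin (n + 1) → S),
    P.IsCycle μ1 st.1 c d ∧
    st'.1 = st.1 \ Set.range c ∧
    (∀ k, st'.2 (c k) = some (d k)) ∧
    ∀ i, i ∉ Set.range c → st'.2 i = st.2 i

/-- `μ2` is the outcome of the restricted Top Trading Cycles stage starting
from `μ1`: beginning with the initially active students and assignment `μ1`,
rounds are iterated until no student is active. -/
def IsTTCOutcome (μ1 μ2 : I → Option S) : Prop :=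
  ∃ (m : ℕ) (st : ℕ → Set I × (I → Option S)),
    st 0 = ({i | P.InitActive μ1 i}, μ1) ∧
    (∀ k < m, P.TTCStep μ1 (st k) (st (k + 1))) ∧
    (st m).1 = ∅ ∧ μ2 = (st m).2

end SchoolChoice


namespace SchoolChoice

/-- A school whose proposers fill it keeps at least `q s` proposers after a round. -/
lemma da_step_full {I S : Type*} [Fintype I] [Fintype S] (P : SchoolChoice I S)
    (R R' : I → Set S) (h : P.DAStep R R') (s : S)
    (hq : P.q s ≤ {j | P.ProposesTo R j (some s)}.ncard) :
    P.q s ≤ {j | P.ProposesTo R' j (some s)}.ncard := by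
  have keep : ∀ j, P.ProposesTo R j (some s) → ¬ P.Rejects R s j →
      P.ProposesTo R' j (some s) := by
    intro j hj hr
    refine ⟨?_, ?_⟩
    · intro t ht
      obtain rfl : s = t := by simpa using ht
      rw [h.2 j]
      rintro (h' | h')
      · exact hj.1 s rfl h'
      · exact hr h'
    · intro o ho
      refine hj.2 o fun t ht hm => ho t ht ?_
      rw [h.2 j]
      exact Or.inl hm
  by_cases hex : ∃ i, P.Rejects R s i
  · obtain ⟨i, hi, hmax⟩ := Set.exists_max_image {i | P.Rejects R s i} (P.wthn s)
      (Set.toFinite _) hex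
    refine le_trans hi.2 (Set.ncard_le_ncard ?_ (Set.toFinite _))
    rintro j ⟨hj, hlt⟩
    exact keep j hj fun hr => absurd (hmax j hr) (not_le.mpr hlt)
  · refine le_trans hq (Set.ncard_le_ncard ?_ (Set.toFinite _))
    intro j hj
    exact keep j hj fun hr => hex ⟨j, hr⟩

end SchoolChoice

open SchoolChoice in
/-- if a student strictly prefers a school to her DA assignment,
then that school is filled to capacity at the DA match. -/
theorem da_preferred_school_full {I S : Type*} [Fintype I] [Fintype S]
    (P : SchoolChoice I S) (μ1 : I → Option S) (h1 : P.IsDAOutcome μ1) :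
    ∀ (i : I) (s : S), P.pref i (μ1 i) < P.pref i (some s) →
      {j | μ1 j = some s}.ncard = P.q s := by
  intro i s hlt
  obtain ⟨n, R, h0, hstep, hterm, hμ⟩ := h1
  have inv : ∀ k ≤ n, ∀ i, s ∈ R k i →
      P.q s ≤ {j | P.ProposesTo (R k) j (some s)}.ncard := by
    intro k
    induction k with
    | zero => intro _ i hi; rw [h0 i] at hi; exact hi.elim
    | succ k ih =>
      intro hk i hi
      have hs := hstep k (by omega)
      refine da_step_full P _ _ hs s ?_
      rw [hs.2 i] at hi
      rcases hi with hi | hi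
      · exact ih (by omega) i hi
      · exact le_trans hi.2 (Set.ncard_le_ncard (fun j hj => hj.1) (Set.toFinite _))
  have heq : {j | μ1 j = some s} = {j | P.ProposesTo (R n) j (some s)} := by
    ext j
    constructor
    · intro hj
      have := hμ j
      rw [show μ1 j = some s from hj] at this
      exact this
    · intro hj
      exact P.pref_inj j (le_antisymm (hj.2 _ (hμ j).1) ((hμ j).2 _ hj.1))
  rw [heq]
  refine le_antisymm (hterm s) (inv n le_rfl i ?_)
  by_contra hn
  refine absurd ((hμ i).2 (some s) ?_) (not_le.mpr hlt)
  intro t ht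
  obtain rfl : s = t := by simpa using ht
  exact hn
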